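/- For every natural number n and every n×n matrix A over a commutative ring R, let G_n be the incidence graph of G'_n, where G'_n carries the vertex weights w(i,j) = A i j and the incidence-graph construction assigns weight −1 to the newly added vertices. Then G_n is bipartite and VCP(G_n, ŵ) = PER*(A). -/

import Mathlib

attribute [local instance] Classical.propDecidable

/-- The partial permanent of an `n × n` matrix: the sum, over all injective partial maps
`π` from `Fin n` to `Fin n`, of the products `∏_{i ∈ dom π} A i (π i)`. -/
noncomputable def partialPerm {n : ℕ} {R : Type*} [CommRing R]
    (A : Matrix (Fin n) (Fin n) R) : R :=
  ∑ f ∈ Finset.univ.filter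
      (fun f : Fin n → Option (Fin n) => ∀ i j k, f i = some k → f j = some k → i = j),
    ∏ i, (f i).elim 1 (fun j => A i j)

/-- The independent set polynomial of a vertex-weighted finite graph. -/
noncomputable def indepPoly {V : Type*} [Fintype V] {R : Type*} [CommRing R]
    (G : SimpleGraph V) (w : V → R) : R :=
  ∑ S ∈ Finset.univ.filter (fun S : Finset V => ∀ a ∈ S, ∀ b ∈ S, ¬ G.Adj a b),
    ∏ v ∈ S, w v

/-- The vertex cover polynomial of a vertex-weighted finite graph. -/
noncomputable def vcPoly {V : Type*} [Fintype V] {R : Type*} [CommRing R]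
    (G : SimpleGraph V) (w : V → R) : R :=
  ∑ C ∈ Finset.univ.filter (fun C : Finset V => ∀ a b, G.Adj a b → a ∈ C ∨ b ∈ C),
    ∏ v ∈ C, w v

/-- The graph `G'_n` on vertex set `Fin n × Fin n`, two distinct vertices being adjacent
iff they share a coordinate. -/
def Gn (n : ℕ) : SimpleGraph (Fin n × Fin n) :=
  SimpleGraph.fromRel (fun p q => p.1 = q.1 ∨ p.2 = q.2)

/-- The incidence graph of a simple graph `G`: the bipartite graph on `V ⊕ G.edgeSet`
in which an edge-vertex `e` is adjacent to a vertex `v` iff `v` is an endpoint of `e`. -/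
def incidenceGraph {V : Type*} (G : SimpleGraph V) :
    SimpleGraph (V ⊕ ↥G.edgeSet) :=
  SimpleGraph.fromRel (fun a b =>
    match a, b with
    | Sum.inl v, Sum.inr e => v ∈ (e : Sym2 V)
    | _, _ => False)

open Finset in
/-- Summing `(-1) ^ #F` over all `F` containing a fixed set `M`. -/
theorem sum_prod_neg_one_of_superset {E R : Type*} [Fintype E] [DecidableEq E] [CommRing R] (M : Finset E) :
    (∑ F : Finset E, if M ⊆ F then ∏ _e ∈ F, (-1 : R) else 0) =
      if M = univ then ∏ _e : E, (-1 : R) else 0 := by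
  have key := Finset.prod_add (fun _ : E => (-1 : R)) (fun e => if e ∈ M then 0 else 1) univ
  have hleft : ∏ e : E, ((-1 : R) + if e ∈ M then 0 else 1) =
      if M = univ then ∏ _e : E, (-1 : R) else 0 := by
    split_ifs with h
    · simp [h]
    · obtain ⟨e, he⟩ : ∃ e, e ∉ M := by simpa [eq_univ_iff_forall] using h
      exact prod_eq_zero (mem_univ e) (by simp [he])
  rw [← hleft, key, powerset_univ]
  refine sum_congr rfl fun F _ => ?_
  split_ifs with h
  · rw [prod_eq_one (s := univ \ F), mul_one]
    intro e he
    have : e ∉ M := fun h' => (mem_sdiff.1 he).2 (h h')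
    simp [this]
  · obtain ⟨e, heM, heF⟩ := not_subset.1 h
    rw [prod_eq_zero (s := univ \ F) (i := e) (by simp [heF]) (by simp [heM]), mul_zero]

theorem incidenceGraph_colorable_two {V : Type*} (G : SimpleGraph V) :
    (incidenceGraph G).Colorable 2 := by
  refine ⟨SimpleGraph.Coloring.mk (Sum.elim (fun _ => 0) (fun _ => 1)) ?_⟩
  rintro (a | a) (b | b) h <;> simp_all [incidenceGraph]

theorem incidenceGraph_cover_iff {V : Type*} (G : SimpleGraph V)
    (S : Finset V) (F : Finset G.edgeSet) :
    (∀ a b, (incidenceGraph G).Adj a b → a ∈ S.disjSum F ∨ b ∈ S.disjSum F) ↔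
      ∀ e : G.edgeSet, (∃ v ∈ (e : Sym2 V), v ∉ S) → e ∈ F := by
  constructor
  · rintro h e ⟨v, hv, hvS⟩
    have := h (Sum.inl v) (Sum.inr e) (by simp [incidenceGraph, hv])
    simpa [hvS] using this
  · rintro h (a | a) (b | b) hab
    · simp [incidenceGraph] at hab
    · have hab : a ∈ (b : Sym2 V) := by simpa [incidenceGraph] using hab
      by_cases ha : a ∈ S
      · simp [ha]
      · simp [h b ⟨a, hab, ha⟩]
    · have hab : b ∈ (a : Sym2 V) := by simpa [incidenceGraph] using hab
      by_cases hb : b ∈ S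
      · simp [hb]
      · simp [h a ⟨b, hab, hb⟩]
    · simp [incidenceGraph] at hab

theorem indep_iff_forall_edgeSet {V : Type*} (G : SimpleGraph V) (S : Finset V) :
    (∀ a ∈ S, ∀ b ∈ S, ¬ G.Adj a b) ↔ ∀ e : G.edgeSet, ∃ v ∈ (e : Sym2 V), v ∉ S := by
  constructor
  · rintro h ⟨e, he⟩
    induction e with
    | _ a b =>
      by_contra! hc
      exact h a (hc a (by simp)) b (hc b (by simp)) he
  · intro h a ha b hb hab
    obtain ⟨v, hv, hvS⟩ := h ⟨s(a, b), hab⟩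
    rcases Sym2.mem_iff.1 hv with rfl | rfl <;> contradiction

open Finset in
theorem sum_finset_sum {V E R : Type*} [Fintype V] [Fintype E] [AddCommMonoid R]
    (f : Finset (V ⊕ E) → R) :
    ∑ C, f C = ∑ S : Finset V, ∑ F : Finset E, f (S.disjSum F) := by
  rw [← Fintype.sum_prod_type' (f := fun S F => f (disjSum S F))]
  exact (Finset.sumEquiv.symm.toEquiv.sum_comp f).symm

open Finset in
theorem vcPoly_incidenceGraph {V R : Type*} [Fintype V] [CommRing R] (G : SimpleGraph V)
    [Fintype G.edgeSet] (w : V → R) :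
    vcPoly (incidenceGraph G) (Sum.elim w (fun _ => -1)) =
      (∏ _e : G.edgeSet, (-1 : R)) * indepPoly G w := by
  rw [vcPoly, sum_filter, sum_finset_sum, indepPoly, sum_filter, mul_sum]
  refine sum_congr rfl fun S _ => ?_
  set M := univ.filter fun e : G.edgeSet => ∃ v ∈ (e : Sym2 V), v ∉ S with hM
  have hindep : M = univ ↔ ∀ a ∈ S, ∀ b ∈ S, ¬ G.Adj a b := by
    rw [indep_iff_forall_edgeSet, hM, filter_eq_self]
    simp only [mem_univ, true_imp_iff]
  trans ∑ F : Finset G.edgeSet, (∏ v ∈ S, w v) * if M ⊆ F then ∏ _e ∈ F, (-1 : R) else 0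
  · refine sum_congr rfl fun F _ => ?_
    have hsub : M ⊆ F ↔ ∀ e : G.edgeSet, (∃ v ∈ (e : Sym2 V), v ∉ S) → e ∈ F := by
      simp only [hM, subset_iff, mem_filter, mem_univ, true_and]
    have hcover := (incidenceGraph_cover_iff G S F).trans hsub.symm
    by_cases h : M ⊆ F
    · rw [if_pos (hcover.2 h), if_pos h, prod_disjSum]
      rfl
    · rw [if_neg (mt hcover.1 h), if_neg h, mul_zero]
  rw [← mul_sum, sum_prod_neg_one_of_superset]
  by_cases h : M = univ
  · rw [if_pos h, if_pos (hindep.1 h), mul_comm]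
  · rw [if_neg h, if_neg (mt hindep.2 h), mul_zero, mul_zero]

theorem Gn_adj {n : ℕ} {p q : Fin n × Fin n} :
    (Gn n).Adj p q ↔ p ≠ q ∧ (p.1 = q.1 ∨ p.2 = q.2) := by
  simp only [Gn, SimpleGraph.fromRel_adj]
  grind

/-- The transposition of coordinates is an automorphism of `G'_n`. -/
theorem Gn_map_swap_mem_edgeSet {n : ℕ} {e : Sym2 (Fin n × Fin n)} (he : e ∈ (Gn n).edgeSet) :
    e.map Prod.swap ∈ (Gn n).edgeSet := by
  induction e with
  | _ p q =>
    rw [Sym2.map_mk, SimpleGraph.mem_edgeSet, Gn_adj] at *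
    grind

theorem Gn_map_swap_ne {n : ℕ} {e : Sym2 (Fin n × Fin n)} (he : e ∈ (Gn n).edgeSet) :
    e.map Prod.swap ≠ e := by
  induction e with
  | _ p q =>
    rw [SimpleGraph.mem_edgeSet, Gn_adj] at he
    rw [Sym2.map_mk, Ne, Sym2.eq_iff]
    obtain ⟨a, b⟩ := p
    obtain ⟨c, d⟩ := q
    simp only [Prod.swap_prod_mk, Prod.mk.injEq, ne_eq] at *
    grind

/-- The number of edges of `G'_n` is even. -/
theorem Gn_prod_edgeSet_neg_one {n : ℕ} {R : Type*} [CommRing R] [Fintype (Gn n).edgeSet] :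
    ∏ _e : (Gn n).edgeSet, (-1 : R) = 1 := by
  refine Finset.prod_involution
    (fun e _ => ⟨(e : Sym2 _).map Prod.swap, Gn_map_swap_mem_edgeSet e.2⟩) ?_ ?_ ?_ ?_
  · simp
  · intro e _ _ h
    exact Gn_map_swap_ne e.2 (congrArg Subtype.val h)
  · simp
  · intro e _
    ext1
    simp [Sym2.map_map]

open Finset in
theorem indepPoly_Gn {n : ℕ} {R : Type*} [CommRing R] (A : Matrix (Fin n) (Fin n) R) :
    indepPoly (Gn n) (fun p => A p.1 p.2) = partialPerm A := by
  symm
  refine sum_bij (fun f _ => univ.filter fun p : Fin n × Fin n => f p.1 = some p.2) ?_ ?_ ?_ ?_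
  · intro f hf
    simp only [mem_filter, mem_univ, true_and, Gn_adj] at *
    rintro ⟨a, b⟩ hp ⟨c, d⟩ hq
    grind
  · intro f _ g _ h
    funext i
    refine Option.ext fun j => ?_
    simpa using Finset.ext_iff.1 h (i, j)
  · intro S hS
    simp only [mem_filter, mem_univ, true_and, Gn_adj] at hS
    have hmem : ∀ i j, (if h : ∃ k, (i, k) ∈ S then some h.choose else none) = some j ↔
        (i, j) ∈ S := by
      intro i j
      split_ifs with h
      · have := h.choose_spec
        grind
      · simp only [false_iff]
        exact fun h' => h ⟨j, h'⟩
    refine ⟨fun i => if h : ∃ k, (i, k) ∈ S then some h.choose else none, ?_, ?_⟩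
    · simp only [mem_filter, mem_univ, true_and, hmem]
      grind
    · ext ⟨i, j⟩
      simp only [mem_filter, mem_univ, true_and, hmem]
  · intro f _
    rw [prod_filter, Fintype.prod_prod_type]
    refine prod_congr rfl fun i _ => ?_
    cases hi : f i <;> simp [hi]

theorem stmt8 {n : ℕ} {R : Type*} [CommRing R] (A : Matrix (Fin n) (Fin n) R) :
    (incidenceGraph (Gn n)).Colorable 2 ∧
    vcPoly (incidenceGraph (Gn n))
        (Sum.elim (fun p => A p.1 p.2) (fun _ => -1))
      = partialPerm A := by
  refine ⟨incidenceGraph_colorable_two _, ?_⟩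
  rw [vcPoly_incidenceGraph, Gn_prod_edgeSet_neg_one, one_mul, indepPoly_Gn]
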